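/- arXiv:2601.12783 — 4 statements merged into one kernel-verified Lean document; each statement's English description precedes it below -/
import Mathlib

section
/- Let A = {a_0 < a_1 < ... < a_k} be a finite set of real-valued actions and u : A × Θ → ℝ a payoff function. Suppose that for each i ∈ {0,…,k} there exists a belief p(i) ∈ Δ_n such that A*(p(i)) = {a_i} (i.e., a_i is the unique maximizer under p(i)). If for every belief p ∈ Δ_n the set A*(p) is convex relative to A (i.e., whenever i ≤ j ≤ l and a_i ∈ A*(p) and a_l ∈ A*(p), then a_j ∈ A*(p)), then the decision problem is quasi-concave: for every belief p ∈ Δ_n and all indices i ≤ j ≤ l in {0,…,k}, u(a_j, p) ≥ min{u(a_i, p), u(a_l, p)}. -/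
noncomputable section
open Finset

/-- The probability simplex over `n+1` states. -/
def simplex (n : ℕ) : Set (Fin (n + 1) → ℝ) :=
  {p | (∀ i, 0 ≤ p i) ∧ ∑ i, p i = 1}

/-- Expected payoff of action `a` under belief `p`. -/
def expPay {α : Type*} {n : ℕ} (u : α → Fin (n + 1) → ℝ) (a : α)
    (p : Fin (n + 1) → ℝ) : ℝ :=
  ∑ i, p i * u a i

lemma convex_simplex (n : ℕ) : Convex ℝ (simplex n) := convex_stdSimplex ℝ (Fin (n + 1))

lemma continuous_expPay {α : Type*} {n : ℕ} (u : α → Fin (n + 1) → ℝ) (a : α) :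
    Continuous (expPay u a) := by
  unfold expPay
  fun_prop

lemma isLinearMap_expPay {α : Type*} {n : ℕ} (u : α → Fin (n + 1) → ℝ) (a : α) :
    IsLinearMap ℝ (expPay u a) where
  map_add p q := by simp [expPay, add_mul, sum_add_distrib]
  map_smul c p := by simp [expPay, mul_sum, mul_assoc]

/-- The beliefs under which `b` is strictly better than `a` form a convex set. -/
lemma convex_expPay_lt {α : Type*} {n : ℕ} (u : α → Fin (n + 1) → ℝ) (a b : α) :
    Convex ℝ {p ∈ simplex n | expPay u a p < expPay u b p} := by
  have h := convex_halfSpace_gt ((isLinearMap_expPay u b).mk' _ -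
    (isLinearMap_expPay u a).mk' _).isLinear 0
  simp only [LinearMap.sub_apply, IsLinearMap.mk'_apply, sub_pos] at h
  exact (convex_simplex n).inter h

/-- The beliefs under which some action in `s` is optimal form a closed set. -/
lemma isClosed_exists_optimal {α : Type*} [Finite α] {n : ℕ} (u : α → Fin (n + 1) → ℝ)
    (s : Set α) : IsClosed {p | ∃ a ∈ s, ∀ m, expPay u m p ≤ expPay u a p} := by
  have h : {p | ∃ a ∈ s, ∀ m, expPay u m p ≤ expPay u a p} =
      ⋃ a ∈ s, ⋂ m, {p | expPay u m p ≤ expPay u a p} := by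
    ext p
    simp
  rw [h]
  exact s.toFinite.isClosed_biUnion fun a _ ↦ isClosed_iInter fun m ↦
    isClosed_le (continuous_expPay u m) (continuous_expPay u a)

/-- with finitely many actions `a 0 < a 1 < ... < a k`, if every
action is uniquely optimal under some belief, and the set of optimal actions is
convex relative to `A` under every belief, then the decision problem is
quasi-concave. -/
theorem stmt0 {n k : ℕ} (a : Fin (k + 1) → ℝ) (ha : StrictMono a)
    (u : Fin (k + 1) → Fin (n + 1) → ℝ)
    (hunique : ∀ i : Fin (k + 1), ∃ p ∈ simplex n,
      ∀ j : Fin (k + 1), j ≠ i → expPay u j p < expPay u i p)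
    (hconvex : ∀ p ∈ simplex n, ∀ i j l : Fin (k + 1), i ≤ j → j ≤ l →
      (∀ m, expPay u m p ≤ expPay u i p) → (∀ m, expPay u m p ≤ expPay u l p) →
      (∀ m, expPay u m p ≤ expPay u j p)) :
    ∀ p ∈ simplex n, ∀ i j l : Fin (k + 1), i ≤ j → j ≤ l →
      min (expPay u i p) (expPay u l p) ≤ expPay u j p := by
  intro p hp i j l hij hjl
  by_contra! hlt
  obtain ⟨hi, hl⟩ := lt_min_iff.mp hlt
  have hij' : i < j := lt_of_le_of_ne hij (by rintro rfl; exact hi.false)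
  have hjl' : j < l := lt_of_le_of_ne hjl (by rintro rfl; exact hl.false)
  obtain ⟨pi, hpi, hpi_opt⟩ := hunique i
  obtain ⟨pl, hpl, hpl_opt⟩ := hunique l
  have optimal_of_unique {b : Fin (k + 1)} {q : Fin (n + 1) → ℝ}
      (h : ∀ m, m ≠ b → expPay u m q < expPay u b q) (m) : expPay u m q ≤ expPay u b q := by
    obtain rfl | hm := eq_or_ne m b
    exacts [le_rfl, (h m hm).le]
  -- Some action beats `j` throughout this connected set, which contains both `pi` and `pl`.
  have hS := IsPreconnected.union p
    (s := {p ∈ simplex n | expPay u j p < expPay u i p})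
    (t := {p ∈ simplex n | expPay u j p < expPay u l p}) ⟨hp, hi⟩ ⟨hp, hl⟩
    (convex_expPay_lt u j i).isPreconnected (convex_expPay_lt u j l).isPreconnected
  have not_optimal {q : Fin (n + 1) → ℝ}
      (hq : q ∈ {p ∈ simplex n | expPay u j p < expPay u i p} ∪
        {p ∈ simplex n | expPay u j p < expPay u l p}) :
      ¬ ∀ m, expPay u m q ≤ expPay u j q := fun h ↦
    hq.elim (fun hq ↦ hq.2.not_ge (h i)) (fun hq ↦ hq.2.not_ge (h l))
  obtain ⟨q, hq, ⟨b, hb, hb_opt⟩, c, hc, hc_opt⟩ := isPreconnected_closed_iff.mp hS _ _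
    (isClosed_exists_optimal u (Set.Iio j)) (isClosed_exists_optimal u (Set.Ioi j))
    (fun q hq ↦ by
      obtain ⟨m, hm⟩ := Finite.exists_max fun m ↦ expPay u m q
      rcases lt_trichotomy m j with h | rfl | h
      exacts [Or.inl ⟨m, h, hm⟩, (not_optimal hq hm).elim, Or.inr ⟨m, h, hm⟩])
    ⟨pi, Or.inl ⟨hpi, hpi_opt j hij'.ne'⟩, i, hij', optimal_of_unique hpi_opt⟩
    ⟨pl, Or.inr ⟨hpl, hpl_opt j hjl'.ne⟩, l, hjl', optimal_of_unique hpl_opt⟩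
  exact not_optimal hq <| hconvex q (hq.elim And.left And.left) b j c (le_of_lt hb) (le_of_lt hc)
    hb_opt hc_opt
end
end

section
/- Let O ⊂ ℝ^k be a nonempty, open, convex set. Let C be a subset of the closure of O that is relatively open in the closure of O, and set C' := C ∩ O and ∂̂C := (frontier of C in ℝ^k) ∩ O. Let D ⊂ ℝ^k be an affine hyperplane and set D̂ := D ∩ O. If (i) ∂̂C ⊆ D̂, (ii) C' is nonempty, and (iii) O \ C' has nonempty interior, then ∂̂C = D̂. -/
open Set

/-- An open set containing `x` contains points on which a nonzero functional takes values
strictly above and strictly below `L x`. -/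
theorem IsOpen.exists_lt_and_gt_of_linearMap_ne_zero {E : Type*} [AddCommGroup E] [Module ℝ E]
    [TopologicalSpace E] [IsTopologicalAddGroup E] [ContinuousSMul ℝ E] {L : E →ₗ[ℝ] ℝ}
    (hL : L ≠ 0) {U : Set E} (hU : IsOpen U) {x : E} (hx : x ∈ U) :
    (∃ y ∈ U, L x < L y) ∧ ∃ y ∈ U, L y < L x := by
  obtain ⟨v, hv⟩ := L.surjective hL 1
  have hopen : IsOpen ((fun t : ℝ => x + t • v) ⁻¹' U) := hU.preimage (by fun_prop)
  obtain ⟨ε, hε, hball⟩ := Metric.isOpen_iff.1 hopen 0 (by simpa using hx)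
  refine ⟨⟨x + (ε / 2) • v, hball ?_, ?_⟩, ⟨x + (-(ε / 2)) • v, hball ?_, ?_⟩⟩
  · simp [abs_of_pos hε, hε]
  · simp [hv, hε]
  · simp [abs_of_pos hε, hε]
  · simp only [map_add, map_smul, hv, smul_eq_mul]
    linarith

/-- A preconnected set missing the frontier of `C` is contained in `C` or in its complement. -/
theorem IsPreconnected.subset_or_subset_compl_of_disjoint_frontier {X : Type*}
    [TopologicalSpace X] {S C : Set X} (hS : IsPreconnected S) (h : Disjoint S (frontier C)) :
    S ⊆ C ∨ S ⊆ Cᶜ := by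
  have hcover : S ⊆ interior C ∪ interior Cᶜ := fun x hx => by
    rw [← compl_frontier_eq_union_interior]
    exact h.notMem_of_mem_left hx
  exact (hS.subset_or_subset isOpen_interior isOpen_interior
    (disjoint_compl_right.mono interior_subset interior_subset) hcover).imp
      (·.trans interior_subset) (·.trans interior_subset)

/-- let `O ⊆ ℝ^k` be nonempty, open, and convex; let `C` be a
relatively open subset of the closure of `O`, `C' := C ∩ O`, and let
`D = {x | L x = c}` be an affine hyperplane. If the part of the frontier of `C`
inside `O` is contained in `D ∩ O`, `C'` is nonempty, and `O \ C'` has nonempty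
interior, then the frontier of `C` inside `O` equals `D ∩ O`. -/
theorem stmt3 {k : ℕ} (O : Set (Fin k → ℝ)) (hOne : O.Nonempty)
    (hOopen : IsOpen O) (hOconv : Convex ℝ O)
    (C : Set (Fin k → ℝ)) (hCsub : C ⊆ closure O)
    (hCopen : ∃ V : Set (Fin k → ℝ), IsOpen V ∧ C = V ∩ closure O)
    (L : (Fin k → ℝ) →ₗ[ℝ] ℝ) (hL : L ≠ 0) (c : ℝ)
    (hsub : frontier C ∩ O ⊆ {x | L x = c} ∩ O)
    (hne : (C ∩ O).Nonempty)
    (hint : (interior (O \ (C ∩ O))).Nonempty) :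
    frontier C ∩ O = {x | L x = c} ∩ O := by
  obtain ⟨V, hV, hCV⟩ := hCopen
  have hC'open : IsOpen (C ∩ O) := by
    have : C ∩ O = V ∩ O := by
      rw [hCV, inter_assoc, inter_eq_right.2 subset_closure]
    exact this ▸ hV.inter hOopen
  refine hsub.antisymm fun x ⟨hxD, hxO⟩ => ⟨?_, hxO⟩
  have hxc : L x = c := hxD
  have hpos : O ∩ {y | c < L y} ⊆ C ∨ O ∩ {y | c < L y} ⊆ Cᶜ :=
    (hOconv.inter (convex_halfSpace_gt L.isLinear c)).isPreconnected
      |>.subset_or_subset_compl_of_disjoint_frontier <| disjoint_left.2 fun y hy hyF =>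
        hy.2.ne' (hsub ⟨hyF, hy.1⟩).1
  have hneg : O ∩ {y | L y < c} ⊆ C ∨ O ∩ {y | L y < c} ⊆ Cᶜ :=
    (hOconv.inter (convex_halfSpace_lt L.isLinear c)).isPreconnected
      |>.subset_or_subset_compl_of_disjoint_frontier <| disjoint_left.2 fun y hy hyF =>
        hy.2.ne (hsub ⟨hyF, hy.1⟩).1
  have hoff {U : Set (Fin k → ℝ)} (hU : IsOpen U) (hUne : U.Nonempty) : ∃ y ∈ U, L y ≠ c := by
    obtain ⟨y, hy⟩ := hUne
    obtain ⟨⟨z, hz, hlt⟩, -⟩ := hU.exists_lt_and_gt_of_linearMap_ne_zero hL hy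
    by_cases h : L y = c
    · exact ⟨z, hz, (h ▸ hlt).ne'⟩
    · exact ⟨y, hy, h⟩
  obtain ⟨p, ⟨hpC, hpO⟩, hp⟩ := hoff hC'open hne
  obtain ⟨q, hqi, hq⟩ := hoff isOpen_interior hint
  obtain ⟨hqO, hqC'⟩ := interior_subset hqi
  have hqC : q ∉ C := fun h => hqC' ⟨h, hqO⟩
  have hsides (U : Set (Fin k → ℝ)) (hU : IsOpen U) (hxU : x ∈ U) :
      (∃ y ∈ U, y ∈ O ∩ {y | c < L y}) ∧ ∃ y ∈ U, y ∈ O ∩ {y | L y < c} := by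
    obtain ⟨⟨y, hy, hlt⟩, ⟨z, hz, hgt⟩⟩ :=
      (hU.inter hOopen).exists_lt_and_gt_of_linearMap_ne_zero hL ⟨hxU, hxO⟩
    exact ⟨⟨y, hy.1, hy.2, hxc ▸ hlt⟩, ⟨z, hz.1, hz.2, hxc ▸ hgt⟩⟩
  rw [frontier_eq_closure_inter_closure]
  simp only [mem_inter_iff, mem_closure_iff]
  rcases hpos with hpos | hpos <;> rcases hneg with hneg | hneg
  · exact absurd (hq.lt_or_gt.elim (fun h => hneg ⟨hqO, h⟩) fun h => hpos ⟨hqO, h⟩) hqC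
  · refine ⟨fun U hU hxU => ?_, fun U hU hxU => ?_⟩
    · obtain ⟨⟨y, hyU, hy⟩, -⟩ := hsides U hU hxU
      exact ⟨y, hyU, hpos hy⟩
    · obtain ⟨-, ⟨y, hyU, hy⟩⟩ := hsides U hU hxU
      exact ⟨y, hyU, hneg hy⟩
  · refine ⟨fun U hU hxU => ?_, fun U hU hxU => ?_⟩
    · obtain ⟨-, ⟨y, hyU, hy⟩⟩ := hsides U hU hxU
      exact ⟨y, hyU, hneg hy⟩
    · obtain ⟨⟨y, hyU, hy⟩, -⟩ := hsides U hU hxU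
      exact ⟨y, hyU, hpos hy⟩
  · exact absurd hpC (hp.lt_or_gt.elim (fun h => hneg ⟨hpO, h⟩) fun h => hpos ⟨hpO, h⟩)
end

section
/- Let A = {a_0 < a_1 < ... < a_k} be a finite set of real-valued actions and u : A × Θ → ℝ a payoff function that is quasi-concave: for every belief p ∈ Δ_n and all indices i ≤ j ≤ l in {0,…,k}, u(a_j, p) ≥ min{u(a_i, p), u(a_l, p)}. Define Δu(a_i, θ) := u(a_i, θ) − u(a_{i−1}, θ) for i ≥ 1. Then there exists a permutation σ of {0,…,n} such that for every i ∈ {1,…,k}, the vector (Δu(a_i, θ_{σ(0)}), …, Δu(a_i, θ_{σ(n)})) is quasi-monotone, i.e., whenever j < l and Δu(a_i, θ_{σ(j)}) > 0, also Δu(a_i, θ_{σ(l)}) ≥ 0. -/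
noncomputable section
open Finset

theorem single_mem_simplex {n : ℕ} (x : Fin (n + 1)) :
    (Pi.single x 1 : Fin (n + 1) → ℝ) ∈ simplex n := by
  refine ⟨fun i => ?_, by simp⟩
  by_cases h : i = x
  · subst h; simp
  · simp [h]

theorem expPay_single {α : Type*} {n : ℕ} (u : α → Fin (n + 1) → ℝ) (a : α)
    (x : Fin (n + 1)) : expPay u a (Pi.single x 1) = u a x := by
  simp [expPay, Pi.single_apply]

/-- Once a quasi-concave finite sequence has strictly decreased, it never strictly increases. -/
theorem increment_nonpos_of_increment_neg {k : ℕ} {f : Fin (k + 1) → ℝ}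
    (hf : ∀ i j l : Fin (k + 1), i ≤ j → j ≤ l → min (f i) (f l) ≤ f j)
    {i j : Fin k} (hij : i ≤ j) (hi : f i.succ - f i.castSucc < 0) :
    f j.succ - f j.castSucc ≤ 0 := by
  have h₁ := hf i.castSucc i.succ j.succ i.castSucc_lt_succ.le (Fin.succ_le_succ_iff.2 hij)
  have h₂ := hf i.castSucc j.castSucc j.succ (Fin.castSucc_le_castSucc_iff.2 hij)
    j.castSucc_lt_succ.le
  rcases min_le_iff.1 h₁ with h | h <;> rcases min_le_iff.1 h₂ with h' | h' <;> linarith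

/-- The index of the first strict decrease of a finite sequence, or `k` if there is none. -/
def firstDecrease {k : ℕ} (f : Fin (k + 1) → ℝ) : ℕ :=
  sInf {m | ∀ h : m < k, f (Fin.succ ⟨m, h⟩) - f (Fin.castSucc ⟨m, h⟩) < 0}

theorem firstDecrease_le {k : ℕ} {f : Fin (k + 1) → ℝ} {i : Fin k}
    (hi : f i.succ - f i.castSucc < 0) : firstDecrease f ≤ i :=
  Nat.sInf_le fun _ => hi

theorem increment_firstDecrease_neg {k : ℕ} {f : Fin (k + 1) → ℝ} (h : firstDecrease f < k) :
    f (Fin.succ ⟨firstDecrease f, h⟩) - f (Fin.castSucc ⟨firstDecrease f, h⟩) < 0 :=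
  Nat.sInf_mem
    (s := {m | ∀ h : m < k, f (Fin.succ ⟨m, h⟩) - f (Fin.castSucc ⟨m, h⟩) < 0})
    ⟨k, fun h => absurd h (lt_irrefl k)⟩ h

/-- if the decision problem with finitely many actions
`a 0 < a 1 < ... < a k` is quasi-concave, then after relabeling the states by
some permutation `σ`, the incremental payoff vector
`(u(a_i, θ_{σ(0)}) - u(a_{i-1}, θ_{σ(0)}), …)` is quasi-monotone for every
`i ∈ {1, …, k}`. -/
theorem stmt4 {n k : ℕ} (a : Fin (k + 1) → ℝ) (ha : StrictMono a)
    (u : Fin (k + 1) → Fin (n + 1) → ℝ)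
    (hqcc : ∀ p ∈ simplex n, ∀ i j l : Fin (k + 1), i ≤ j → j ≤ l →
      min (expPay u i p) (expPay u l p) ≤ expPay u j p) :
    ∃ σ : Equiv.Perm (Fin (n + 1)), ∀ i : Fin k, ∀ j l : Fin (n + 1), j < l →
      0 < u i.succ (σ j) - u i.castSucc (σ j) →
      0 ≤ u i.succ (σ l) - u i.castSucc (σ l) := by
  have hf : ∀ x, ∀ i j l : Fin (k + 1), i ≤ j → j ≤ l → min (u i x) (u l x) ≤ u j x := by
    intro x i j l hij hjl
    simpa only [expPay_single] using hqcc _ (single_mem_simplex x) i j l hij hjl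
  let N : Fin (n + 1) → ℕ := fun x => firstDecrease fun i => u i x
  refine ⟨Tuple.sort N, fun i j l hjl hpos => ?_⟩
  have hN : N (Tuple.sort N j) ≤ N (Tuple.sort N l) := Tuple.monotone_sort N hjl.le
  by_contra! hneg
  have hle : N (Tuple.sort N j) ≤ i :=
    hN.trans (firstDecrease_le (f := fun i => u i (Tuple.sort N l)) hneg)
  exact hpos.not_ge (increment_nonpos_of_increment_neg (hf _) (Fin.le_def.2 hle)
    (increment_firstDecrease_neg (hle.trans_lt i.isLt)))
end
end

section
/- Let f, g : [l, r] → ℝ (with l < r) be differentiable and quasi-concave on [l, r]. Let m be the least maximizer of f on [l, r] and m' the least maximizer of g on [l, r], and suppose m ≤ m'. Then for every a ∈ (l, r): if f'(a) > 0, then g'(a) ≥ 0. -/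
open Set

/-- let `f` and `g` be differentiable and quasi-concave on
`[l, r]`, let `m` be the least maximizer of `f` on `[l, r]` and `m'` the least
maximizer of `g` on `[l, r]`, with `m ≤ m'`. Then for every `a ∈ (l, r)`,
`f'(a) > 0` implies `g'(a) ≥ 0`. -/
theorem stmt14 (l r : ℝ) (hlr : l < r) (f g : ℝ → ℝ)
    (hfd : DifferentiableOn ℝ f (Icc l r))
    (hgd : DifferentiableOn ℝ g (Icc l r))
    (hfq : ∀ x ∈ Icc l r, ∀ y ∈ Icc l r, ∀ z ∈ Icc l r,
      x ≤ y → y ≤ z → min (f x) (f z) ≤ f y)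
    (hgq : ∀ x ∈ Icc l r, ∀ y ∈ Icc l r, ∀ z ∈ Icc l r,
      x ≤ y → y ≤ z → min (g x) (g z) ≤ g y)
    (m m' : ℝ) (hm : m ∈ Icc l r) (hm' : m' ∈ Icc l r)
    (hmmax : ∀ x ∈ Icc l r, f x ≤ f m)
    (hmleast : ∀ x ∈ Icc l r, (∀ y ∈ Icc l r, f y ≤ f x) → m ≤ x)
    (hm'max : ∀ x ∈ Icc l r, g x ≤ g m')
    (hm'least : ∀ x ∈ Icc l r, (∀ y ∈ Icc l r, g y ≤ g x) → m' ≤ x)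
    (hmm' : m ≤ m') :
    ∀ a ∈ Ioo l r, 0 < deriv f a → 0 ≤ deriv g a := by
  intro a ha hfa
  have haI : a ∈ Icc l r := Ioo_subset_Icc_self ha
  have hnhds : Icc l r ∈ nhds a := Icc_mem_nhds ha.1 ha.2
  have ham : a < m := by
    by_contra! hma
    have hanti : AntitoneOn f (Icc a r) := by
      intro x hx y hy hxy
      have h := hfq m hm x ⟨ha.1.le.trans hx.1, hx.2⟩ y ⟨ha.1.le.trans hy.1, hy.2⟩
        (hma.trans hx.1) hxy
      rwa [min_eq_right (hmmax y ⟨ha.1.le.trans hy.1, hy.2⟩)] at h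
    have h := hanti.derivWithin_nonpos (x := a)
    rw [(hfd.differentiableAt hnhds).derivWithin
      (uniqueDiffOn_Icc ha.2 a (left_mem_Icc.2 ha.2.le))] at h
    exact absurd hfa h.not_gt
  have hmono : MonotoneOn g (Icc l a) := by
    intro x hx y hy hxy
    have hxI : x ∈ Icc l r := ⟨hx.1, hx.2.trans haI.2⟩
    have h := hgq x hxI y ⟨hy.1, hy.2.trans haI.2⟩ m' hm' hxy
      (hy.2.trans (ham.le.trans hmm'))
    rwa [min_eq_left (hm'max x hxI)] at h
  have h := hmono.derivWithin_nonneg (x := a)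
  rwa [(hgd.differentiableAt hnhds).derivWithin
    (uniqueDiffOn_Icc ha.1 a (right_mem_Icc.2 ha.1.le))] at h
end
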